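/- Let p ≥ 1, let G be an α-critical finite simple graph on n vertices with G ∈ W_p, let r = α(G) ≥ 2, and let H be the complement of G. If the minimum degree of H satisfies δ(H) > n(3r−4)/(3r−1), then H is complete r-partite; equivalently, G is the disjoint union of r complete graphs, each of order at least p. -/

import Mathlib

open Finset
open scoped Classical

/-- `S` is an independent set of the graph `G`. -/
def IsIndep {V : Type*} (G : SimpleGraph V) (S : Finset V) : Prop :=
  ∀ ⦃x⦄, x ∈ S → ∀ ⦃y⦄, y ∈ S → x ≠ y → ¬ G.Adj x y

/-- The independence number `α(G)` of a finite graph `G`. -/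
noncomputable def alpha {V : Type*} [Fintype V] (G : SimpleGraph V) : ℕ :=
  Finset.univ.sup fun S : Finset V => if IsIndep G S then S.card else 0

/-- `S` is a maximum independent set of `G`. -/
def IsMaxIndep {V : Type*} [Fintype V] (G : SimpleGraph V) (S : Finset V) : Prop :=
  IsIndep G S ∧ S.card = alpha G

/-- `S` is a maximal (inclusion-wise) independent set of `G`. -/
def IsMaximalIndep {V : Type*} [DecidableEq V] (G : SimpleGraph V) (S : Finset V) : Prop :=
  IsIndep G S ∧ ∀ x, x ∉ S → ¬ IsIndep G (insert x S)

/-- `G` is well-covered: every maximal independent set has cardinality `α(G)`. -/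
def WellCovered {V : Type*} [Fintype V] [DecidableEq V] (G : SimpleGraph V) : Prop :=
  ∀ S : Finset V, IsMaximalIndep G S → S.card = alpha G

/-- `G ∈ W_p`: `|V(G)| ≥ p` and every `p` pairwise disjoint independent sets extend to
`p` pairwise disjoint maximum independent sets. -/
def MemW {V : Type*} [Fintype V] (G : SimpleGraph V) (p : ℕ) : Prop :=
  p ≤ Fintype.card V ∧
    ∀ A : Fin p → Finset V, (∀ i, IsIndep G (A i)) →
      (∀ i j, i ≠ j → Disjoint (A i) (A j)) →
      ∃ M : Fin p → Finset V, (∀ i, IsMaxIndep G (M i)) ∧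
        (∀ i j, i ≠ j → Disjoint (M i) (M j)) ∧ ∀ i, A i ⊆ M i

/-- The `W`-index of `G`: the largest `p` with `G ∈ W_p`. -/
noncomputable def wIndex {V : Type*} [Fintype V] (G : SimpleGraph V) : ℕ :=
  sSup {p : ℕ | MemW G p}

/-- The fiber `F_G(S)`: the vertices `x ∉ S` with `S ∪ {x}` a maximum independent set. -/
noncomputable def fiber {V : Type*} [Fintype V] [DecidableEq V]
    (G : SimpleGraph V) (S : Finset V) : Finset V :=
  Finset.univ.filter fun x => x ∉ S ∧ IsMaxIndep G (insert x S)

/-- `G` is `α`-critical: deleting any edge increases the independence number. -/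
def AlphaCritical {V : Type*} [Fintype V] (G : SimpleGraph V) : Prop :=
  ∀ x y, G.Adj x y → alpha G < alpha (G.deleteEdges {s(x, y)})

/-- `H` is `K_t`-saturated: `H` is `K_t`-free but adding any missing edge creates a `K_t`. -/
def KSaturated {V : Type*} [Fintype V] (H : SimpleGraph V) (t : ℕ) : Prop :=
  (∀ Q : Finset V, ¬ H.IsNClique t Q) ∧
    ∀ x y : V, x ≠ y → ¬ H.Adj x y →
      ∃ Q : Finset V, (H ⊔ SimpleGraph.fromEdgeSet {s(x, y)}).IsNClique t Q

/-- `Q` is an inclusion-maximal clique of `H`. -/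
def IsMaximalClique {V : Type*} [DecidableEq V] (H : SimpleGraph V) (Q : Finset V) : Prop :=
  H.IsClique (Q : Set V) ∧ ∀ x, x ∉ Q → ¬ H.IsClique ((insert x Q : Finset V) : Set V)

/-- The `(r-1)`-clique-codegree of `Q` in `H`: the number of vertices extending `Q`
to an `r`-clique of `H`. -/
noncomputable def codeg {V : Type*} [Fintype V] [DecidableEq V]
    (H : SimpleGraph V) (r : ℕ) (Q : Finset V) : ℕ :=
  (Finset.univ.filter fun x => x ∉ Q ∧ H.IsNClique r (insert x Q)).card

/-- The minimum `(r-1)`-clique-codegree `δ^cl_{r-1}(H)`. -/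
noncomputable def minCliqueCodeg {V : Type*} [Fintype V] [DecidableEq V]
    (H : SimpleGraph V) (r : ℕ) : ℕ :=
  sInf {m : ℕ | ∃ Q : Finset V, H.IsNClique (r - 1) Q ∧ codeg H r Q = m}

/-- The vertex set of the localization `G_S = G - N_G[S]`. -/
noncomputable def localVerts {V : Type*} [Fintype V] (G : SimpleGraph V) (S : Finset V) :
    Finset V :=
  Finset.univ.filter fun v => v ∉ S ∧ ∀ s ∈ S, ¬ G.Adj s v

/-- The localization `G_S = G - N_G[S]`, as an induced subgraph. -/
noncomputable def localize {V : Type*} [Fintype V] (G : SimpleGraph V) (S : Finset V) :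
    SimpleGraph {v : V // v ∈ localVerts G S} :=
  SimpleGraph.comap (fun v => (v : V)) G

/-- The vertex set of the edge-localization `G_{ab} = G - (N_G(a) ∪ N_G(b))`. -/
noncomputable def edgeVerts {V : Type*} [Fintype V] (G : SimpleGraph V) (a b : V) : Finset V :=
  Finset.univ.filter fun v => ¬ G.Adj a v ∧ ¬ G.Adj b v

/-- The edge-localization `G_{ab} = G - (N_G(a) ∪ N_G(b))`, as an induced subgraph. -/
noncomputable def edgeLocalize {V : Type*} [Fintype V] (G : SimpleGraph V) (a b : V) :
    SimpleGraph {v : V // v ∈ edgeVerts G a b} :=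
  SimpleGraph.comap (fun v => (v : V)) G

/-- `H` is complete `r`-partite: its vertex set partitions into `r` nonempty parts,
and two vertices are adjacent iff they lie in different parts. -/
def CompleteMultipartite {V : Type*} (H : SimpleGraph V) (r : ℕ) : Prop :=
  ∃ P : Fin r → Finset V, (∀ v, ∃! i, v ∈ P i) ∧ (∀ i, (P i).Nonempty) ∧
    ∀ x y, H.Adj x y ↔ ∃ i j, i ≠ j ∧ x ∈ P i ∧ y ∈ P j

/-- `G` is the disjoint union of `r` complete graphs, each of order at least `p`. -/
def DisjUnionCliques {V : Type*} (G : SimpleGraph V) (r p : ℕ) : Prop :=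
  ∃ P : Fin r → Finset V, (∀ v, ∃! i, v ∈ P i) ∧ (∀ i, p ≤ (P i).card) ∧
    ∀ x y, G.Adj x y ↔ ∃ i, x ∈ P i ∧ y ∈ P i ∧ x ≠ y

theorem IsIndep.card_le_alpha {V : Type*} [Fintype V] {G : SimpleGraph V} {S : Finset V}
    (hS : IsIndep G S) : S.card ≤ alpha G := by
  have h := Finset.le_sup (f := fun S : Finset V => if IsIndep G S then S.card else 0)
    (Finset.mem_univ S)
  simpa [hS, alpha] using h

theorem exists_isMaxIndep {V : Type*} [Fintype V] (G : SimpleGraph V) :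
    ∃ S : Finset V, IsMaxIndep G S := by
  obtain ⟨S, -, hS⟩ := Finset.exists_mem_eq_sup Finset.univ Finset.univ_nonempty
    (fun S : Finset V => if IsIndep G S then S.card else 0)
  by_cases h : IsIndep G S
  · exact ⟨S, h, by simpa [h, alpha] using hS.symm⟩
  · refine ⟨∅, by simp [IsIndep], ?_⟩
    simpa [h, alpha] using hS.symm

theorem cliqueFree_compl_alpha_succ {V : Type*} [Fintype V] (G : SimpleGraph V) :
    Gᶜ.CliqueFree (alpha G + 1) := by
  intro S hS
  have hind : IsIndep G S := fun x hx y hy hxy => (hS.isClique hx hy hxy).2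
  have := hind.card_le_alpha
  have := hS.card_eq
  omega

/-- In an `α`-critical graph, a colouring of the complement with `α(G)` colours has
exactly the cliques of `G` as colour classes. -/
theorem AlphaCritical.adj_iff_of_coloring {V : Type*} [Fintype V] {G : SimpleGraph V}
    (hcrit : AlphaCritical G) {r : ℕ} (hr : r ≤ alpha G) (C : Gᶜ.Coloring (Fin r)) (x y : V) :
    G.Adj x y ↔ C x = C y ∧ x ≠ y := by
  refine ⟨fun hxy => ⟨?_, hxy.ne⟩, fun ⟨hC, hne⟩ => ?_⟩
  · by_contra hC
    obtain ⟨S, hS, hcard⟩ := exists_isMaxIndep (G.deleteEdges {s(x, y)})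
    have hinj : Set.InjOn C S := by
      intro u hu v hv huv
      by_contra hne
      have hadj := hS hu hv hne
      by_cases hG : G.Adj u v
      · have he : s(u, v) = s(x, y) := by
          by_contra he
          exact hadj (by simpa [SimpleGraph.deleteEdges_adj, hG] using he)
        rcases Sym2.eq_iff.mp he with ⟨rfl, rfl⟩ | ⟨rfl, rfl⟩
        · exact hC huv
        · exact hC huv.symm
      · exact C.valid ((SimpleGraph.compl_adj G u v).2 ⟨hne, hG⟩) huv
    have hle := Finset.card_le_card_of_injOn C (fun _ _ => Finset.mem_univ _) hinj
    rw [Finset.card_univ, Fintype.card_fin] at hle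
    have := hcrit x y hxy
    omega
  · by_contra hG
    exact C.valid ((SimpleGraph.compl_adj G x y).2 ⟨hne, hG⟩) hC

theorem IsMaxIndep.exists_mem_color {V : Type*} [Fintype V] {G : SimpleGraph V}
    {S : Finset V} (hS : IsMaxIndep G S) (C : Gᶜ.Coloring (Fin (alpha G)))
    (c : Fin (alpha G)) : ∃ v ∈ S, C v = c := by
  have hinj : Set.InjOn C S := by
    intro u hu v hv huv
    by_contra hne
    exact C.valid ((SimpleGraph.compl_adj G u v).2 ⟨hne, hS.1 hu hv hne⟩) huv
  obtain ⟨v, hv, hc⟩ := Finset.surj_on_of_inj_on_of_card_le (s := S) (t := Finset.univ)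
    (fun v _ => C v) (fun _ _ => Finset.mem_univ _)
    (fun _ _ hu hv h => hinj hu hv h) (by simp [hS.2]) c (Finset.mem_univ c)
  exact ⟨v, hv, hc.symm⟩

theorem MemW.le_card_color {V : Type*} [Fintype V] {G : SimpleGraph V} {p : ℕ}
    (hW : MemW G p) (C : Gᶜ.Coloring (Fin (alpha G))) (c : Fin (alpha G)) :
    p ≤ (Finset.univ.filter fun v => C v = c).card := by
  obtain ⟨M, hM, hdisj, -⟩ := hW.2 (fun _ => ∅) (by simp [IsIndep]) (by simp)
  choose f hfM hfC using fun i => (hM i).exists_mem_color C c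
  have hinj : Function.Injective f := by
    intro i j hij
    by_contra hne
    exact Finset.disjoint_left.mp (hdisj i j hne) (hfM i) (hij ▸ hfM j)
  simpa using Finset.card_le_card_of_injOn (s := Finset.univ) f
    (t := Finset.univ.filter fun v => C v = c) (fun i _ => by simp [hfC i]) hinj.injOn

/-- Dense complement rigidity. -/
theorem dense_complement_rigidity {V : Type*} [Fintype V] [DecidableEq V]
    (G : SimpleGraph V) (p r : ℕ) (hp : 1 ≤ p)
    (hcrit : AlphaCritical G) (hW : MemW G p) (hr : 2 ≤ r) (halpha : alpha G = r)
    (hdeg : (Fintype.card V : ℚ) * (3 * (r : ℚ) - 4) / (3 * (r : ℚ) - 1)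
      < (Gᶜ.minDegree : ℚ)) :
    CompleteMultipartite Gᶜ r ∧ DisjUnionCliques G r p := by
  subst halpha
  have hdeg' : (3 * alpha G - 4) * Fintype.card V / (3 * alpha G - 1) < Gᶜ.minDegree := by
    have hr' : (2 : ℚ) ≤ alpha G := by exact_mod_cast hr
    rw [div_lt_iff₀ (by linarith)] at hdeg
    rw [Nat.div_lt_iff_lt_mul (by omega)]
    have h4 : ((3 * alpha G - 4 : ℕ) : ℚ) = 3 * alpha G - 4 := by
      rw [Nat.cast_sub (by omega)]; push_cast; ring
    have h1 : ((3 * alpha G - 1 : ℕ) : ℚ) = 3 * alpha G - 1 := by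
      rw [Nat.cast_sub (by omega)]; push_cast; ring
    rw [← Nat.cast_lt (α := ℚ), Nat.cast_mul, Nat.cast_mul, h4, h1]
    linarith
  obtain ⟨C⟩ := SimpleGraph.colorable_of_cliqueFree_lt_minDegree
    (cliqueFree_compl_alpha_succ G) hdeg'
  have hadj := hcrit.adj_iff_of_coloring le_rfl C
  have hcard := hW.le_card_color C
  refine ⟨⟨fun i => Finset.univ.filter fun v => C v = i, by simp, fun i => ?_, fun x y => ?_⟩,
    ⟨fun i => Finset.univ.filter fun v => C v = i, by simp, hcard, fun x y => ?_⟩⟩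
  · exact Finset.card_pos.mp (hp.trans (hcard i))
  · rw [SimpleGraph.compl_adj, hadj]
    simp only [Finset.mem_filter, Finset.mem_univ, true_and]
    constructor
    · rintro ⟨hne, h⟩
      exact ⟨C x, C y, fun hC => h ⟨hC, hne⟩, rfl, rfl⟩
    · rintro ⟨i, j, hij, rfl, rfl⟩
      exact ⟨fun h => hij (h ▸ rfl), fun h => hij h.1⟩
  · rw [hadj]
    simp only [Finset.mem_filter, Finset.mem_univ, true_and]
    exact ⟨fun ⟨h, hne⟩ => ⟨C y, h, rfl, hne⟩, fun ⟨_, hx, hy, hne⟩ => ⟨hx.trans hy.symm, hne⟩⟩
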